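/- Let L be a (left) Leibniz algebra over a field F, let A ⊆ L be an ideal with L·A ⊆ A and A·L = 0, let X = L × L with multiplication (x, w)·(x', w') = (x·x', x·w'), D = {(a, -a) : a ∈ A}, and M = X/D. Let L̄ be the image of L × {0} in M, B the image of {0} × L in M, and Ā the image of A × {0} in M. Then the map x ↦ (x, 0) + D is an injective homomorphism of Leibniz algebras from L onto L̄, and one has L̄ + B = M and L̄ ∩ B = Ā. -/

import Mathlib

/-- Construction 3 continued: the map `x ↦ (x, 0) + D` is an injective Leibniz
algebra homomorphism of `L` onto `L̄ ⊆ M = X/D`, with `L̄ + B = M` and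
`L̄ ∩ B = Ā`. -/
theorem splitting_algebra_embedding (F : Type*) [Field F] (L : Type*)
    [AddCommGroup L] [Module F L]
    (mul : L →ₗ[F] L →ₗ[F] L)
    (leib : ∀ x y z : L, mul x (mul y z) = mul (mul x y) z + mul y (mul x z))
    (A : Submodule F L)
    (hLA : ∀ x : L, ∀ a ∈ A, mul x a ∈ A)
    (hAL : ∀ a ∈ A, ∀ x : L, mul a x = 0) :
    let D : Submodule F (L × L) :=
      A.map ((LinearMap.id : L →ₗ[F] L).prod (-LinearMap.id))
    let M := (L × L) ⧸ D
    let B : Submodule F M := (LinearMap.range (LinearMap.inr F L L)).map D.mkQ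
    let Lbar : Submodule F M := (LinearMap.range (LinearMap.inl F L L)).map D.mkQ
    let Abar : Submodule F M := (A.map (LinearMap.inl F L L)).map D.mkQ
    let φ : L →ₗ[F] M := D.mkQ ∘ₗ LinearMap.inl F L L
    ∀ mulM : M →ₗ[F] M →ₗ[F] M,
      (∀ p q : L × L, mulM (D.mkQ p) (D.mkQ q) = D.mkQ (mul p.1 q.1, mul p.1 q.2)) →
      Function.Injective φ ∧
      (∀ x y : L, φ (mul x y) = mulM (φ x) (φ y)) ∧
      LinearMap.range φ = Lbar ∧
      Lbar ⊔ B = ⊤ ∧ Lbar ⊓ B = Abar := by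
  intro D M B Lbar Abar φ mulM hmul
  have mem_D (p : L × L) : p ∈ D ↔ p.1 ∈ A ∧ p.2 = -p.1 := by
    constructor
    · rintro ⟨a, ha, rfl⟩
      exact ⟨ha, rfl⟩
    · rintro ⟨h, h'⟩
      exact ⟨p.1, h, Prod.ext rfl h'.symm⟩
  have mkQ_eq (p q : L × L) : D.mkQ p = D.mkQ q ↔ p - q ∈ D := Submodule.Quotient.eq D
  refine ⟨?_, ?_, LinearMap.range_comp _ _, ?_, ?_⟩
  · refine (injective_iff_map_eq_zero φ).2 fun x hx => ?_
    have h : ((x, 0) : L × L) ∈ D := (Submodule.Quotient.mk_eq_zero D).1 hx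
    simpa [eq_comm] using ((mem_D _).1 h).2
  · intro x y
    have h : ((mul x y, 0) : L × L) = (mul x y, mul x 0) := by rw [map_zero]
    exact (congrArg D.mkQ h).trans (hmul (x, 0) (y, 0)).symm
  · change Submodule.map _ _ ⊔ Submodule.map _ _ = ⊤
    rw [← Submodule.map_sup, LinearMap.sup_range_inl_inr, Submodule.map_top,
      Submodule.range_mkQ]
  · apply le_antisymm
    · rintro _ ⟨⟨_, ⟨x, rfl⟩, rfl⟩, ⟨_, ⟨w, rfl⟩, h⟩⟩
      have hx := ((mem_D _).1 ((mkQ_eq _ _).1 h.symm)).1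
      exact ⟨(x, 0), ⟨x, by simpa using hx, rfl⟩, rfl⟩
    · rintro _ ⟨_, ⟨a, ha, rfl⟩, rfl⟩
      refine ⟨⟨_, ⟨a, rfl⟩, rfl⟩, ⟨_, ⟨a, rfl⟩, ?_⟩⟩
      exact ((mkQ_eq _ _).2 ((mem_D _).2 (by simpa using ha))).symm
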